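/- arXiv:2005.14577 — 2 statements merged into one kernel-verified Lean document; each statement's English description precedes it below -/
import Mathlib

section
/- Let R be a commutative Noetherian integral domain with a distinguished invertible element q^{1/2} (write q = (q^{1/2})^2), and let Q be an antisymmetric r×r integer matrix. Then the quantum torus T(Q) is a Noetherian ring and has no zero divisors (i.e., T(Q) is a Noetherian domain). -/
open scoped BigOperators Matrix

/-- Defining relations of the quantum torus `T(Q)` over a commutative ring `R`
with distinguished invertible element `sqq = q^{1/2}` (so `q = sqq^2`):
generators `x_i = ι (Sum.inl i)` and their inverses `x_i⁻¹ = ι (Sum.inr i)`,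
relations `x_i x_i⁻¹ = x_i⁻¹ x_i = 1` and `x_i x_j = q^{Q i j} x_j x_i`. -/
inductive QTRel (R : Type) [CommRing R] (sqq : Rˣ) {r : ℕ} (Q : Matrix (Fin r) (Fin r) ℤ) :
    FreeAlgebra R (Fin r ⊕ Fin r) → FreeAlgebra R (Fin r ⊕ Fin r) → Prop
  | mul_inv (i : Fin r) :
      QTRel R sqq Q (FreeAlgebra.ι R (Sum.inl i) * FreeAlgebra.ι R (Sum.inr i)) 1
  | inv_mul (i : Fin r) :
      QTRel R sqq Q (FreeAlgebra.ι R (Sum.inr i) * FreeAlgebra.ι R (Sum.inl i)) 1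
  | qcomm (i j : Fin r) :
      QTRel R sqq Q (FreeAlgebra.ι R (Sum.inl i) * FreeAlgebra.ι R (Sum.inl j))
        (((sqq ^ (2 * Q i j) : Rˣ) : R) •
          (FreeAlgebra.ι R (Sum.inl j) * FreeAlgebra.ι R (Sum.inl i)))

/-- The quantum torus `T(Q)`. -/
def QuantumTorus (R : Type) [CommRing R] (sqq : Rˣ) {r : ℕ}
    (Q : Matrix (Fin r) (Fin r) ℤ) : Type :=
  RingQuot (QTRel R sqq Q)

noncomputable instance (R : Type) [CommRing R] (sqq : Rˣ) {r : ℕ}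
    (Q : Matrix (Fin r) (Fin r) ℤ) : Ring (QuantumTorus R sqq Q) :=
  inferInstanceAs (Ring (RingQuot (QTRel R sqq Q)))

noncomputable instance (R : Type) [CommRing R] (sqq : Rˣ) {r : ℕ}
    (Q : Matrix (Fin r) (Fin r) ℤ) : Algebra R (QuantumTorus R sqq Q) :=
  inferInstanceAs (Algebra R (RingQuot (QTRel R sqq Q)))

namespace QuantumTorus

variable {R : Type} [CommRing R] (sqq : Rˣ) {r : ℕ} (Q : Matrix (Fin r) (Fin r) ℤ)

/-- The generator `x_i` of the quantum torus. -/
noncomputable def X (i : Fin r) : QuantumTorus R sqq Q :=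
  RingQuot.mkAlgHom R (QTRel R sqq Q) (FreeAlgebra.ι R (Sum.inl i))

/-- The inverse generator `x_i⁻¹` of the quantum torus. -/
noncomputable def Xinv (i : Fin r) : QuantumTorus R sqq Q :=
  RingQuot.mkAlgHom R (QTRel R sqq Q) (FreeAlgebra.ι R (Sum.inr i))

/-- `x_i^k` for `k : ℤ`, using the inverse generator for negative powers. -/
noncomputable def genPow (i : Fin r) (k : ℤ) : QuantumTorus R sqq Q :=
  if 0 ≤ k then X sqq Q i ^ k.toNat else Xinv sqq Q i ^ (-k).toNat

end QuantumTorus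

/-- The pairing `⟨k,k'⟩_Q = ∑_{i,j} Q i j * k i * k' j`. -/
def quantumPairing {r : ℕ} (Q : Matrix (Fin r) (Fin r) ℤ) (k k' : Fin r → ℤ) : ℤ :=
  ∑ i, ∑ j, Q i j * k i * k' j

/-- The sum `∑_{i<j} Q i j * k i * k j` used to normalize monomials. -/
def quantumUpperSum {r : ℕ} (Q : Matrix (Fin r) (Fin r) ℤ) (k : Fin r → ℤ) : ℤ :=
  ∑ i, ∑ j, if i < j then Q i j * k i * k j else 0

/-- The normalized monomial
`x^k = q^{-(1/2) ∑_{i<j} Q i j k_i k_j} x_1^{k_1} ⋯ x_r^{k_r}`. -/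
noncomputable def QuantumTorus.monomial {R : Type} [CommRing R] (sqq : Rˣ) {r : ℕ}
    (Q : Matrix (Fin r) (Fin r) ℤ) (k : Fin r → ℤ) : QuantumTorus R sqq Q :=
  ((sqq ^ (-(quantumUpperSum Q k)) : Rˣ) : R) •
    ((List.finRange r).map (fun i => QuantumTorus.genPow sqq Q i (k i))).prod

/-! ### Skew Laurent extensions of Noetherian rings -/

namespace SkewLaurent

variable {R B : Type*} [CommRing R] [Ring B] [Algebra R B]

/-- The left `A`-module spanned by `1, x, …, x ^ (n - 1)`. -/
def degreeLT (A : Subalgebra R B) (x : Bˣ) (n : ℕ) : Submodule A B :=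
  Submodule.span A ((fun j : ℕ => (x : B) ^ j) '' Set.Iio n)

variable {A : Subalgebra R B} {x : Bˣ}

lemma inv_pow_mul_pow_mul (x : Bˣ) (k : ℕ) (s : B) :
    ((x⁻¹ : Bˣ) : B) ^ k * ((x : B) ^ k * s) = s := by
  rw [← Units.val_pow_eq_pow_val, ← Units.val_pow_eq_pow_val, inv_pow, Units.inv_mul_cancel_left]

lemma pow_mul_mul (x : Bˣ) (k : ℕ) (a s : B) :
    (x : B) ^ k * (a * s) = (x : B) ^ k * a * ((x⁻¹ : Bˣ) : B) ^ k * ((x : B) ^ k * s) := by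
  rw [mul_assoc _ (((x⁻¹ : Bˣ) : B) ^ k), inv_pow_mul_pow_mul, mul_assoc]

lemma degreeLT_mono {m n : ℕ} (h : m ≤ n) : degreeLT A x m ≤ degreeLT A x n :=
  Submodule.span_mono (Set.image_mono (Set.Iio_subset_Iio h))

lemma conj_pow_mem (hx : ∀ a ∈ A, (x : B) * a * (x⁻¹ : Bˣ) ∈ A) (n : ℕ) {a : B} (ha : a ∈ A) :
    (x : B) ^ n * a * (x⁻¹ : Bˣ) ^ n ∈ A := by
  induction n with
  | zero => simpa using ha
  | succ n ih =>
    convert hx _ ih using 1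
    rw [pow_succ', pow_succ]
    simp only [mul_assoc]

lemma pow_mul_mem_degreeLT (hx : ∀ a ∈ A, (x : B) * a * (x⁻¹ : Bˣ) ∈ A) (k : ℕ) {n : ℕ} {s : B}
    (hs : s ∈ degreeLT A x n) : (x : B) ^ k * s ∈ degreeLT A x (n + k) := by
  induction hs using Submodule.span_induction with
  | mem s hs =>
    obtain ⟨j, hj, rfl⟩ := hs
    exact Submodule.subset_span ⟨k + j, by simpa [add_comm k] using hj, by simp [pow_add]⟩
  | zero => simp
  | add s t _ _ hs ht => rw [mul_add]; exact add_mem hs ht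
  | smul a s _ hs =>
    convert Submodule.smul_mem _ (⟨_, conj_pow_mem hx k a.2⟩ : A) hs using 1
    exact pow_mul_mul x k a s

lemma exists_sub_mem_degreeLT (hx' : ∀ a ∈ A, ((x⁻¹ : Bˣ) : B) * a * x ∈ A) {n : ℕ} {s : B}
    (hs : s ∈ degreeLT A x (n + 1)) : ∃ a : A, s - (x : B) ^ n * a ∈ degreeLT A x n := by
  have hset : Set.Iio (n + 1) = insert n (Set.Iio n) := by ext; simp [le_iff_eq_or_lt]
  rw [degreeLT, hset, Set.image_insert_eq, Submodule.mem_span_insert] at hs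
  obtain ⟨a, z, hz, rfl⟩ := hs
  change z ∈ degreeLT A x n at hz
  refine ⟨⟨_, conj_pow_mem (x := x⁻¹) (by simpa using hx') n a.2⟩, ?_⟩
  convert hz using 1
  have h := inv_pow_mul_pow_mul x⁻¹ n ((a : B) * (x : B) ^ n)
  simp only [inv_inv] at h ⊢
  rw [mul_assoc, h, Subalgebra.smul_def, smul_eq_mul, add_sub_cancel_left]

/-- The leading coefficients, written to the right of `x ^ n`, of the elements of `I` of
degree at most `n`. -/
def leadingCoeffs (hx : ∀ a ∈ A, (x : B) * a * (x⁻¹ : Bˣ) ∈ A) (I : Ideal B) (n : ℕ) :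
    Ideal A where
  carrier := {a | ∃ f ∈ I, f - (x : B) ^ n * a ∈ degreeLT A x n}
  zero_mem' := ⟨0, I.zero_mem, by simp⟩
  add_mem' := by
    rintro a b ⟨f, hf, hfa⟩ ⟨g, hg, hgb⟩
    refine ⟨f + g, I.add_mem hf hg, ?_⟩
    convert add_mem hfa hgb using 1
    push_cast
    noncomm_ring
  smul_mem' := by
    rintro b a ⟨f, hf, hfa⟩
    refine ⟨_, I.mul_mem_left ((x : B) ^ n * b * (x⁻¹ : Bˣ) ^ n) hf, ?_⟩
    convert Submodule.smul_mem _ (⟨_, conj_pow_mem hx n b.2⟩ : A) hfa using 1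
    simp only [Subalgebra.smul_def, smul_eq_mul, mul_sub, Subalgebra.coe_mul, pow_mul_mul x n (b : B)]

lemma leadingCoeffs_mono (hx : ∀ a ∈ A, (x : B) * a * (x⁻¹ : Bˣ) ∈ A) (I : Ideal B) :
    Monotone (leadingCoeffs hx I) := by
  refine monotone_nat_of_le_succ fun n a ⟨f, hf, hfa⟩ => ⟨x * f, I.mul_mem_left _ hf, ?_⟩
  convert pow_mul_mem_degreeLT hx 1 hfa using 1
  simp [pow_succ', mul_sub, mul_assoc]

lemma exists_pow_mul_mem_degreeLT (hx : ∀ a ∈ A, (x : B) * a * (x⁻¹ : Bˣ) ∈ A)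
    (hgen : Algebra.adjoin R ((A : Set B) ∪ {(x : B), ((x⁻¹ : Bˣ) : B)}) = ⊤) (t : B) :
    ∃ k n, (x : B) ^ k * t ∈ degreeLT A x n := by
  suffices h : ∀ s : B, (∃ k n, (x : B) ^ k * s ∈ degreeLT A x n) →
      ∃ k n, (x : B) ^ k * (t * s) ∈ degreeLT A x n by
    simpa using h 1 ⟨0, 1, Submodule.subset_span ⟨0, by simp⟩⟩
  have ht : t ∈ Algebra.adjoin R ((A : Set B) ∪ {(x : B), ((x⁻¹ : Bˣ) : B)}) := hgen ▸ trivial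
  have hA : ∀ a ∈ A, ∀ s : B, (∃ k n, (x : B) ^ k * s ∈ degreeLT A x n) →
      ∃ k n, (x : B) ^ k * (a * s) ∈ degreeLT A x n := by
    rintro a ha s ⟨k, n, hs⟩
    refine ⟨k, n, ?_⟩
    convert Submodule.smul_mem _ (⟨_, conj_pow_mem hx k ha⟩ : A) hs using 1
    exact pow_mul_mul x k a s
  induction ht using Algebra.adjoin_induction with
  | mem t ht =>
    rcases ht with ht | rfl | rfl
    · exact hA t ht
    · rintro s ⟨k, n, hs⟩
      refine ⟨k, n + 1, ?_⟩
      convert pow_mul_mem_degreeLT hx 1 hs using 1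
      rw [pow_one, ← mul_assoc, ← mul_assoc, ← pow_succ, ← pow_succ']
    · rintro s ⟨k, n, hs⟩
      refine ⟨k + 1, n, ?_⟩
      rwa [pow_succ, mul_assoc, Units.mul_inv_cancel_left]
  | algebraMap r => exact hA _ (A.algebraMap_mem r)
  | add t u _ _ ht hu =>
    intro s hs
    obtain ⟨k, n, h⟩ := ht s hs
    obtain ⟨l, m, h'⟩ := hu s hs
    have h₁ := pow_mul_mem_degreeLT hx l h
    have h₂ := pow_mul_mem_degreeLT hx k h'
    rw [← mul_assoc, ← pow_add] at h₁ h₂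
    refine ⟨l + k, (n + l) + (m + k), ?_⟩
    rw [add_mul, mul_add]
    exact add_mem (degreeLT_mono (Nat.le_add_right _ _) h₁)
      (degreeLT_mono (Nat.le_add_left _ _) (add_comm l k ▸ h₂))
  | mul t u _ _ ht hu =>
    intro s hs
    simpa only [mul_assoc] using ht _ (hu s hs)

/-- **Hilbert's basis theorem** for skew Laurent extensions: a ring generated by a left Noetherian
subalgebra `A` and a unit normalizing `A` is left Noetherian. -/
theorem isNoetherianRing [IsNoetherianRing A] (hx : ∀ a ∈ A, (x : B) * a * (x⁻¹ : Bˣ) ∈ A)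
    (hx' : ∀ a ∈ A, ((x⁻¹ : Bˣ) : B) * a * x ∈ A)
    (hgen : Algebra.adjoin R ((A : Set B) ∪ {(x : B), ((x⁻¹ : Bˣ) : B)}) = ⊤) :
    IsNoetherianRing B := by
  refine (isNoetherianRing_iff_ideal_fg B).2 fun I => ?_
  obtain ⟨d, hd⟩ := monotone_stabilizes_iff_noetherian.2 (inferInstanceAs (IsNoetherian A A))
    ⟨leadingCoeffs hx I, leadingCoeffs_mono hx I⟩
  let M : Submodule A B := I.restrictScalars A ⊓ degreeLT A x (d + 1)
  have hM : M.FG := by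
    have : IsNoetherian A (degreeLT A x (d + 1)) :=
      isNoetherian_span_of_finite A ((Set.finite_Iio _).image _)
    exact isNoetherian_submodule.1 this _ inf_le_right
  obtain ⟨G, hG⟩ := hM
  have hMG : ∀ f ∈ M, f ∈ Ideal.span (G : Set B) := fun f hf =>
    Submodule.span_subset_span A B (G : Set B) (hG.symm ▸ hf)
  refine ⟨G, le_antisymm (Ideal.span_le.2 fun g hg => ?_) fun f hf => ?_⟩
  · exact (hG ▸ Submodule.subset_span hg : g ∈ M).1
  have key : ∀ n, ∀ f ∈ I, f ∈ degreeLT A x n → f ∈ Ideal.span (G : Set B) := by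
    intro n
    induction n with
    | zero => exact fun f hf hfn => hMG f ⟨hf, degreeLT_mono (by omega) hfn⟩
    | succ n ih =>
      intro f hf hfn
      rcases le_or_gt n d with hnd | hnd
      · exact hMG f ⟨hf, degreeLT_mono (by omega) hfn⟩
      obtain ⟨a, ha⟩ := exists_sub_mem_degreeLT hx' hfn
      have haL : a ∈ leadingCoeffs hx I d := by
        have : leadingCoeffs hx I d = leadingCoeffs hx I n := hd n hnd.le
        exact this ▸ ⟨f, hf, ha⟩
      obtain ⟨g, hg, hga⟩ := haL
      have hgd : g ∈ degreeLT A x (d + 1) := by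
        have hxa : (x : B) ^ d * a ∈ degreeLT A x (d + 1) := by
          rw [add_comm]
          refine pow_mul_mem_degreeLT hx d ?_
          simpa [Subalgebra.smul_def] using Submodule.smul_mem (degreeLT A x 1) a
            (Submodule.subset_span ⟨0, by simp⟩ : ((x : B) ^ 0) ∈ degreeLT A x 1)
        simpa using add_mem (degreeLT_mono d.le_succ hga) hxa
      have hsub : f - (x : B) ^ (n - d) * g ∈ degreeLT A x n := by
        have h := pow_mul_mem_degreeLT hx (n - d) hga
        rw [Nat.add_sub_cancel' hnd.le] at h
        convert sub_mem ha h using 1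
        rw [mul_sub, ← mul_assoc, ← pow_add, Nat.sub_add_cancel hnd.le]
        abel
      have h := add_mem (ih _ (I.sub_mem hf (I.mul_mem_left _ hg)) hsub)
        ((Ideal.span (G : Set B)).mul_mem_left ((x : B) ^ (n - d)) (hMG g ⟨hg, hgd⟩))
      simpa using h
  obtain ⟨k, n, hkn⟩ := exists_pow_mul_mem_degreeLT hx hgen f
  have h := (Ideal.span (G : Set B)).mul_mem_left (((x ^ k)⁻¹ : Bˣ) : B)
    (key n _ (I.mul_mem_left _ hf) hkn)
  rwa [← Units.val_pow_eq_pow_val, Units.inv_mul_cancel_left] at h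

end SkewLaurent

open scoped commutatorElement

/-! ### Ordered monomials in a group -/

section OrderedMonomial

variable {G H : Type*} [Group G] [Group H]

/-- The ordered monomial `y₀ ^ k₀ * y₁ ^ k₁ * ⋯`. -/
def orderedMonomial {n : ℕ} (y : Fin n → G) (k : Fin n → ℤ) : G :=
  (List.ofFn fun i => y i ^ k i).prod

lemma orderedMonomial_succ {n : ℕ} (y : Fin (n + 1) → G) (k : Fin (n + 1) → ℤ) :
    orderedMonomial y k =
      y 0 ^ k 0 * orderedMonomial (fun i => y i.succ) (fun i => k i.succ) := by
  simp [orderedMonomial, List.ofFn_succ]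

@[simp]
lemma orderedMonomial_zero {n : ℕ} (y : Fin n → G) : orderedMonomial y 0 = 1 := by
  simp [orderedMonomial]

lemma map_orderedMonomial (f : G →* H) {n : ℕ} (y : Fin n → G) (k : Fin n → ℤ) :
    f (orderedMonomial y k) = orderedMonomial (fun i => f (y i)) k := by
  simp [orderedMonomial, map_list_prod, List.map_ofFn, Function.comp_def]

lemma orderedMonomial_mem {K : Subgroup G} {n : ℕ} {y : Fin n → G} (hy : ∀ i, y i ∈ K)
    (k : Fin n → ℤ) : orderedMonomial y k ∈ K := by
  refine K.list_prod_mem fun g hg => ?_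
  obtain ⟨i, rfl⟩ := List.mem_ofFn.1 hg
  exact K.zpow_mem (hy i) _

lemma exists_mul_zpow_eq {Z : Subgroup G} (hZ : Z ≤ Subgroup.center G) {a b : G}
    (h : ⁅a, b⁆ ∈ Z) (k : ℤ) : ∃ c ∈ Z, a * b ^ k = c * (b ^ k * a) := by
  refine ⟨⁅a, b⁆ ^ k, Z.zpow_mem h k, ?_⟩
  have hc : Commute ⁅a, b⁆ b := (Subgroup.mem_center_iff.1 (hZ h) b).symm
  rw [← mul_assoc, ← hc.mul_zpow, commutatorElement_def, inv_mul_cancel_right, conj_zpow,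
    inv_mul_cancel_right]

lemma exists_mul_orderedMonomial_eq {Z : Subgroup G} (hZ : Z ≤ Subgroup.center G) {n : ℕ}
    (y : Fin n → G) (hy : ∀ i j, ⁅y i, y j⁆ ∈ Z) (i : Fin n) (k : Fin n → ℤ) :
    ∃ c ∈ Z, y i * orderedMonomial y k = c * orderedMonomial y (k + Pi.single i 1) := by
  induction n with
  | zero => exact i.elim0
  | succ n ih =>
    simp only [orderedMonomial_succ]
    refine Fin.cases ?_ (fun j => ?_) i
    · exact ⟨1, Z.one_mem, by simp [← mul_assoc, zpow_add, (Commute.zpow_self (y 0) _).eq]⟩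
    · obtain ⟨c, hc, hcy⟩ := exists_mul_zpow_eq hZ (hy j.succ 0) (k 0)
      obtain ⟨d, hd, hdy⟩ := ih (fun i => y i.succ) (fun _ _ => hy _ _) j (fun i => k i.succ)
      refine ⟨c * d, Z.mul_mem hc hd, ?_⟩
      have hk : (fun i : Fin n => (k + Pi.single j.succ 1 : Fin (n + 1) → ℤ) i.succ) =
          (fun i => k i.succ) + Pi.single j 1 := by
        ext i
        simp [Pi.single_apply]
      rw [← mul_assoc, hcy, mul_assoc, mul_assoc, hdy, hk, ← mul_assoc (y 0 ^ k 0),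
        Subgroup.mem_center_iff.1 (hZ hd)]
      simp [mul_assoc]

end OrderedMonomial

/-! ### Algebras generated by units commuting up to scalars -/

section QuasiCommuting

variable (R S : Type*) [CommRing R] [Ring S] [Algebra R S]

/-- The units of `S` coming from units of the base ring. -/
def scalarUnits : Subgroup Sˣ := (Units.map (algebraMap R S : R →* S)).range

lemma scalarUnits_le_center : scalarUnits R S ≤ Subgroup.center Sˣ := by
  rintro _ ⟨c, rfl⟩
  exact Subgroup.mem_center_iff.2 fun g => Units.ext (Algebra.commutes (c : R) (g : S)).symm

variable {S}

/-- The subalgebra generated by a family of units and their inverses. -/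
def unitsAdjoin {ι : Type*} (y : ι → Sˣ) : Subalgebra R S :=
  Algebra.adjoin R (Set.range (fun i => (y i : S)) ∪ Set.range (fun i => ((y i)⁻¹ : Sˣ).val))

variable {R}

lemma val_mem_unitsAdjoin {ι : Type*} (y : ι → Sˣ) (i : ι) : (y i : S) ∈ unitsAdjoin R y :=
  Algebra.subset_adjoin (.inl ⟨i, rfl⟩)

lemma inv_mem_unitsAdjoin {ι : Type*} (y : ι → Sˣ) (i : ι) :
    ((y i)⁻¹ : Sˣ).val ∈ unitsAdjoin R y :=
  Algebra.subset_adjoin (.inr ⟨i, rfl⟩)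

lemma conj_mem_unitsAdjoin {ι : Type*} {y : ι → Sˣ} {g : Sˣ}
    (hg : ∀ i, ⁅g, y i⁆ ∈ scalarUnits R S) {a : S} (ha : a ∈ unitsAdjoin R y) :
    (g : S) * a * (g⁻¹ : Sˣ) ∈ unitsAdjoin R y := by
  have hconj : ∀ i, ∃ c : Rˣ, g * y i * g⁻¹ = Units.map (algebraMap R S : R →* S) c * y i := by
    intro i
    obtain ⟨c, hc⟩ := hg i
    exact ⟨c, by rw [hc, commutatorElement_def, inv_mul_cancel_right]⟩
  induction ha using Algebra.adjoin_induction with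
  | mem a ha =>
    rcases ha with ⟨i, rfl⟩ | ⟨i, rfl⟩
    · obtain ⟨c, hc⟩ := hconj i
      have h := congrArg Units.val hc
      simp only [Units.val_mul] at h
      rw [h]
      exact mul_mem (algebraMap_mem _ _) (val_mem_unitsAdjoin y i)
    · obtain ⟨c, hc⟩ := hconj i
      have h := congrArg (fun u : Sˣ => (u⁻¹).val) hc
      simp only [mul_inv_rev, inv_inv, ← map_inv, ← mul_assoc, Units.val_mul] at h
      rw [h]
      exact mul_mem (inv_mem_unitsAdjoin y i) (algebraMap_mem _ _)
  | algebraMap r =>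
    rw [← Algebra.commutes, mul_assoc, Units.mul_inv, mul_one]
    exact algebraMap_mem _ _
  | add a b _ _ ha hb => rw [mul_add, add_mul]; exact add_mem ha hb
  | mul a b _ _ ha hb =>
    convert mul_mem ha hb using 1
    simp only [mul_assoc, Units.inv_mul_cancel_left]

/-- An algebra over a Noetherian ring generated by finitely many units (and their inverses)
which commute up to scalars is left Noetherian. -/
theorem isNoetherianRing_of_quasiCommuting {R : Type*} [CommRing R] [IsNoetherianRing R] {n : ℕ}
    {S : Type*} [Ring S] [Algebra R S] (y : Fin n → Sˣ)
    (hy : ∀ i j, ⁅y i, y j⁆ ∈ scalarUnits R S) (hgen : unitsAdjoin R y = ⊤) :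
    IsNoetherianRing S := by
  induction n generalizing S with
  | zero =>
    refine isNoetherianRing_of_surjective R S (algebraMap R S) fun s => ?_
    have hs : s ∈ unitsAdjoin R y := hgen ▸ trivial
    simpa [unitsAdjoin, Algebra.mem_bot] using hs
  | succ n ih =>
    let A := unitsAdjoin R fun i => y (Fin.succ i)
    let z : Fin n → Aˣ := fun i =>
      ⟨⟨_, val_mem_unitsAdjoin _ i⟩, ⟨_, inv_mem_unitsAdjoin _ i⟩,
        Subtype.ext (Units.mul_inv _), Subtype.ext (Units.inv_mul _)⟩
    have hA : IsNoetherianRing A := by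
      refine ih z (fun i j => ?_) ?_
      · obtain ⟨c, hc⟩ := hy i.succ j.succ
        exact ⟨c, Units.ext (Subtype.ext (congrArg Units.val hc))⟩
      · refine eq_top_iff.2 (le_of_eq_of_le Algebra.adjoin_adjoin_coe_preimage.symm
          (Algebra.adjoin_mono fun a ha => ?_))
        rcases ha with ⟨i, hi⟩ | ⟨i, hi⟩
        · exact .inl ⟨i, Subtype.ext hi⟩
        · exact .inr ⟨i, Subtype.ext hi⟩
    refine SkewLaurent.isNoetherianRing (A := A) (x := y 0)
      (fun a => conj_mem_unitsAdjoin fun i => hy _ _) (fun a ha => ?_) ?_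
    · suffices h : ∀ i : Fin n, ⁅(y 0)⁻¹, y i.succ⁆ ∈ scalarUnits R S by
        simpa using conj_mem_unitsAdjoin h ha
      intro i
      have h := (scalarUnits R S).inv_mem (hy 0 i.succ)
      rw [commutatorElement_inv] at h
      have hc := Subgroup.mem_center_iff.1 (scalarUnits_le_center R S h) (y 0)⁻¹
      rw [eq_mul_inv_of_mul_eq hc.symm] at h
      simpa [commutatorElement_def, mul_assoc] using h
    · rw [eq_top_iff, ← hgen]
      refine Algebra.adjoin_mono ?_
      rintro _ (⟨i, rfl⟩ | ⟨i, rfl⟩) <;> refine Fin.cases ?_ (fun j => ?_) i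
      · exact .inr (.inl rfl)
      · exact .inl (val_mem_unitsAdjoin _ j)
      · exact .inr (.inr rfl)
      · exact .inl (inv_mem_unitsAdjoin _ j)

theorem span_orderedMonomial_eq_top {n : ℕ} (y : Fin n → Sˣ)
    (hy : ∀ i j, ⁅y i, y j⁆ ∈ scalarUnits R S) (hgen : unitsAdjoin R y = ⊤) :
    Submodule.span R (Set.range fun k => ((orderedMonomial y k : Sˣ) : S)) = ⊤ := by
  set N := Submodule.span R (Set.range fun k => ((orderedMonomial y k : Sˣ) : S))
  have hmul : ∀ i k, ∃ c : Rˣ,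
      (y i : S) * orderedMonomial y k = (c : R) • ((orderedMonomial y (k + Pi.single i 1) : Sˣ) : S) := by
    intro i k
    obtain ⟨_, ⟨c, rfl⟩, hc⟩ :=
      exists_mul_orderedMonomial_eq (scalarUnits_le_center R S) y hy i k
    exact ⟨c, by simpa [Algebra.smul_def] using congrArg Units.val hc⟩
  have hmono : ∀ k, ((orderedMonomial y k : Sˣ) : S) ∈ N := fun k => Submodule.subset_span ⟨k, rfl⟩
  have hstable : ∀ t : S, (∀ k, t * orderedMonomial y k ∈ N) → ∀ s ∈ N, t * s ∈ N := by
    intro t ht s hs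
    induction hs using Submodule.span_induction with
    | mem s hs => obtain ⟨k, rfl⟩ := hs; exact ht k
    | zero => simp
    | add s s' _ _ hs hs' => rw [mul_add]; exact add_mem hs hs'
    | smul r s _ hs => rw [mul_smul_comm]; exact N.smul_mem r hs
  refine eq_top_iff.2 fun t _ => ?_
  suffices h : ∀ s ∈ N, t * s ∈ N by simpa using h 1 (by simpa using hmono 0)
  have ht : t ∈ unitsAdjoin R y := hgen ▸ trivial
  induction ht using Algebra.adjoin_induction with
  | mem t ht =>
    rcases ht with ⟨i, rfl⟩ | ⟨i, rfl⟩ <;> refine hstable _ fun k => ?_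
    · obtain ⟨c, hc⟩ := hmul i k
      exact hc ▸ N.smul_mem _ (hmono _)
    · obtain ⟨c, hc⟩ := hmul i (k - Pi.single i 1)
      have h := N.smul_mem ((c⁻¹ : Rˣ) : R) (hmono (k - Pi.single i 1))
      rw [sub_add_cancel] at hc
      convert h using 1
      rw [Units.inv_mul_eq_iff_eq_mul, mul_smul_comm, hc, smul_smul, Units.inv_mul, one_smul]
  | algebraMap r =>
    intro s hs
    rw [← Algebra.smul_def]
    exact N.smul_mem r hs
  | add t u _ _ ht hu =>
    intro s hs
    rw [add_mul]
    exact add_mem (ht trivial s hs) (hu trivial s hs)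
  | mul t u _ _ ht hu =>
    intro s hs
    rw [mul_assoc]
    exact ht trivial _ (hu trivial s hs)

end QuasiCommuting

/-! ### Homogeneous units for a representation on `G →₀ R` -/

section Homogeneous

variable {R S G : Type*} [CommRing R] [Ring S] [Algebra R S] [AddCommGroup G]

/-- The pairs `(g, u)` such that `u` sends every basis vector `e_l` to a unit multiple
of `e_{g + l}`. -/
def homogeneousUnits (ρ : S →ₐ[R] Module.End R (G →₀ R)) :
    Subgroup (Multiplicative G × Sˣ) where
  carrier := {p | ∀ l, ∃ c : Rˣ,
    ρ p.2 (Finsupp.single l 1) = Finsupp.single (p.1.toAdd + l) (c : R)}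
  one_mem' l := ⟨1, by simp⟩
  mul_mem' := by
    intro p p' hp hp' l
    obtain ⟨c, hc⟩ := hp' l
    obtain ⟨d, hd⟩ := hp (p'.1.toAdd + l)
    refine ⟨c * d, ?_⟩
    simp only [Prod.snd_mul, Units.val_mul, map_mul, Module.End.mul_apply, hc]
    rw [← mul_one (c : R), ← smul_eq_mul, ← Finsupp.smul_single, map_smul, hd]
    simp [add_assoc]
  inv_mem' := by
    intro p hp l
    obtain ⟨c, hc⟩ := hp (-p.1.toAdd + l)
    refine ⟨c⁻¹, ?_⟩
    have h := congrArg (ρ (p.2⁻¹ : Sˣ)) hc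
    rw [← Module.End.mul_apply, ← map_mul, Units.inv_mul, map_one, Module.End.one_apply,
      add_neg_cancel_left, ← mul_one (c : R), ← smul_eq_mul, ← Finsupp.smul_single, map_smul] at h
    have h' := congrArg (((c⁻¹ : Rˣ) : R) • ·) h
    simp only [smul_smul, Units.inv_mul, one_smul] at h'
    simpa using h'.symm

theorem noZeroDivisors_of_homogeneous [IsDomain R] [UniqueSums G]
    (ρ : S →ₐ[R] Module.End R (G →₀ R)) (m : G → Sˣ)
    (hm : ∀ g, (Multiplicative.ofAdd g, m g) ∈ homogeneousUnits ρ)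
    (hspan : Submodule.span R (Set.range fun g => (m g : S)) = ⊤) : NoZeroDivisors S where
  eq_zero_or_eq_zero_of_mul_eq_zero := by
    intro s t hst
    by_contra! h
    obtain ⟨hs, ht⟩ := h
    obtain ⟨f, rfl⟩ := Finsupp.mem_span_range_iff_exists_finsupp.1
      (hspan ▸ trivial : s ∈ Submodule.span R (Set.range fun g => (m g : S)))
    obtain ⟨f', rfl⟩ := Finsupp.mem_span_range_iff_exists_finsupp.1
      (hspan ▸ trivial : t ∈ Submodule.span R (Set.range fun g => (m g : S)))
    have hf : f.support.Nonempty := by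
      rw [Finsupp.support_nonempty_iff]; rintro rfl; simp at hs
    have hf' : f'.support.Nonempty := by
      rw [Finsupp.support_nonempty_iff]; rintro rfl; simp at ht
    obtain ⟨a, ha, b, hb, hab⟩ := UniqueSums.uniqueAdd_of_nonempty hf hf'
    have hmul : ∀ g h, ∃ c : Rˣ,
        ρ (m g * m h) (Finsupp.single 0 1) = Finsupp.single (g + h) (c : R) := by
      intro g h
      simpa using mul_mem (hm g) (hm h) 0
    choose c hc using hmul
    have h := congrArg (fun u => ρ u (Finsupp.single 0 1) (a + b)) hst
    simp only [Finsupp.sum, Finset.sum_mul_sum, ← Finset.sum_product', smul_mul_smul_comm,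
      map_sum, map_smul, LinearMap.sum_apply, LinearMap.smul_apply, hc, Finsupp.finsetSum_apply,
      Finsupp.smul_apply, map_zero, LinearMap.zero_apply, Finsupp.zero_apply] at h
    rw [Finset.sum_eq_single (a, b)] at h
    · simp at h ha hb
      tauto
    · rintro ⟨a', b'⟩ hmem hne
      rw [Finset.mem_product] at hmem
      rw [Finsupp.single_eq_of_ne, smul_zero]
      intro heq
      exact hne (Prod.ext_iff.2 (hab hmem.1 hmem.2 heq.symm))
    · exact fun hn => (hn (Finset.mem_product.2 ⟨ha, hb⟩)).elim

end Homogeneous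

/-! ### The quantum torus -/

namespace QuantumTorus

variable {R : Type} [CommRing R] (sqq : Rˣ) {r : ℕ} (Q : Matrix (Fin r) (Fin r) ℤ)

/-- The generator `x_i` as a unit. -/
noncomputable def unitX (i : Fin r) : (QuantumTorus R sqq Q)ˣ where
  val := X sqq Q i
  inv := Xinv sqq Q i
  val_inv := by
    have h := RingQuot.mkAlgHom_rel R (QTRel.mul_inv (R := R) (sqq := sqq) (Q := Q) i)
    rw [map_mul, map_one] at h
    exact h
  inv_val := by
    have h := RingQuot.mkAlgHom_rel R (QTRel.inv_mul (R := R) (sqq := sqq) (Q := Q) i)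
    rw [map_mul, map_one] at h
    exact h

lemma commutator_unitX_mem (i j : Fin r) :
    ⁅unitX sqq Q i, unitX sqq Q j⁆ ∈ scalarUnits R (QuantumTorus R sqq Q) := by
  refine ⟨sqq ^ (2 * Q i j), ?_⟩
  have h : X sqq Q i * X sqq Q j = ((sqq ^ (2 * Q i j) : Rˣ) : R) • (X sqq Q j * X sqq Q i) := by
    have h := RingQuot.mkAlgHom_rel R (QTRel.qcomm (R := R) (sqq := sqq) (Q := Q) i j)
    rw [map_mul, map_smul, map_mul] at h
    exact h
  rw [commutatorElement_def, eq_mul_inv_iff_mul_eq, eq_mul_inv_iff_mul_eq, mul_assoc]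
  refine Units.ext (Eq.trans ?_ h.symm)
  rw [Algebra.smul_def]
  rfl

lemma unitsAdjoin_unitX : unitsAdjoin R (unitX sqq Q) = ⊤ := by
  refine eq_top_iff.2 fun t _ => ?_
  obtain ⟨a, rfl⟩ := RingQuot.mkAlgHom_surjective R (QTRel R sqq Q) t
  have ha : a ∈ Algebra.adjoin R (Set.range (FreeAlgebra.ι R)) :=
    FreeAlgebra.adjoin_range_ι R (Fin r ⊕ Fin r) ▸ trivial
  induction ha using Algebra.adjoin_induction with
  | mem a ha =>
    obtain ⟨i | i, rfl⟩ := ha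
    · exact val_mem_unitsAdjoin _ i
    · exact inv_mem_unitsAdjoin _ i
  | algebraMap c =>
    rw [AlgHom.commutes]
    exact algebraMap_mem (unitsAdjoin R (unitX sqq Q)) c
  | add a b _ _ ha hb =>
    rw [map_add]
    exact add_mem (ha trivial) (hb trivial)
  | mul a b _ _ ha hb =>
    rw [map_mul]
    exact mul_mem (ha trivial) (hb trivial)

/-- The operator by which `x_i` acts on `R[ℤ ^ r]`. -/
noncomputable def opX (i : Fin r) : Module.End R ((Fin r → ℤ) →₀ R) :=
  Finsupp.linearCombination R fun k =>
    Finsupp.single (Pi.single i 1 + k) ((sqq ^ (Q *ᵥ k) i : Rˣ) : R)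

/-- The operator by which `x_i⁻¹` acts on `R[ℤ ^ r]`. -/
noncomputable def opXinv (i : Fin r) : Module.End R ((Fin r → ℤ) →₀ R) :=
  Finsupp.linearCombination R fun k =>
    Finsupp.single (k - Pi.single i 1) ((sqq ^ (-(Q *ᵥ (k - Pi.single i 1)) i) : Rˣ) : R)

lemma opX_single (i : Fin r) (k : Fin r → ℤ) (c : R) :
    opX sqq Q i (Finsupp.single k c) =
      Finsupp.single (Pi.single i 1 + k) (c * (sqq ^ (Q *ᵥ k) i : Rˣ)) := by
  simp [opX]

lemma opXinv_single (i : Fin r) (k : Fin r → ℤ) (c : R) :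
    opXinv sqq Q i (Finsupp.single k c) = Finsupp.single (k - Pi.single i 1)
      (c * (sqq ^ (-(Q *ᵥ (k - Pi.single i 1)) i) : Rˣ)) := by
  simp [opXinv]

variable {Q}

/-- The representation of the quantum torus on `R[ℤ ^ r]`. -/
noncomputable def rep (hQ : Qᵀ = -Q) :
    QuantumTorus R sqq Q →ₐ[R] Module.End R ((Fin r → ℤ) →₀ R) :=
  RingQuot.liftAlgHom R ⟨FreeAlgebra.lift R (Sum.elim (opX sqq Q) (opXinv sqq Q)), by
    rintro _ _ (i | i | ⟨i, j⟩)
    · refine Finsupp.lhom_ext fun k c => ?_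
      simp only [map_mul, map_one, FreeAlgebra.lift_ι_apply, Sum.elim_inl, Sum.elim_inr,
        Module.End.mul_apply, Module.End.one_apply, opX_single, opXinv_single]
      rw [add_sub_cancel, mul_assoc, ← Units.val_mul, ← zpow_add, neg_add_cancel, zpow_zero,
        Units.val_one, mul_one]
    · refine Finsupp.lhom_ext fun k c => ?_
      simp only [map_mul, map_one, FreeAlgebra.lift_ι_apply, Sum.elim_inl, Sum.elim_inr,
        Module.End.mul_apply, Module.End.one_apply, opX_single, opXinv_single]
      rw [add_sub_cancel_left, mul_assoc, ← Units.val_mul, ← zpow_add, add_neg_cancel, zpow_zero,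
        Units.val_one, mul_one]
    · refine Finsupp.lhom_ext fun k c => ?_
      have hji : Q j i = -Q i j := congrFun (congrFun hQ i) j
      simp only [map_mul, map_smul, FreeAlgebra.lift_ι_apply, Sum.elim_inl, Module.End.mul_apply,
        LinearMap.smul_apply, opX_single, Finsupp.smul_single, smul_eq_mul]
      rw [add_left_comm]
      congr 1
      rw [mul_assoc, mul_assoc, mul_left_comm _ c, ← Units.val_mul, ← Units.val_mul, ← Units.val_mul,
        ← zpow_add, ← zpow_add, ← zpow_add]
      congr 3
      simp only [Matrix.mulVec_add, Pi.add_apply, Matrix.mulVec_single_one, Matrix.col_apply, hji]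
      ring⟩

lemma rep_X (hQ : Qᵀ = -Q) (i : Fin r) : rep sqq hQ (X sqq Q i) = opX sqq Q i := by
  refine (RingQuot.liftAlgHom_mkAlgHom_apply R _ _ _).trans ?_
  simp

lemma orderedMonomial_mem_homogeneousUnits (hQ : Qᵀ = -Q) (k : Fin r → ℤ) :
    (Multiplicative.ofAdd k, orderedMonomial (unitX sqq Q) k) ∈
      homogeneousUnits (rep sqq hQ) := by
  let y : Fin r → Multiplicative (Fin r → ℤ) × (QuantumTorus R sqq Q)ˣ :=
    fun i => (Multiplicative.ofAdd (Pi.single i 1), unitX sqq Q i)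
  have hy : ∀ i, y i ∈ homogeneousUnits (rep sqq hQ) := fun i l =>
    ⟨sqq ^ (Q *ᵥ l) i, by
      change rep sqq hQ (X sqq Q i) _ = _
      rw [rep_X, opX_single, one_mul]
      rfl⟩
  convert orderedMonomial_mem hy k using 1
  refine Prod.ext ?_ (map_orderedMonomial (MonoidHom.snd _ _) y k).symm
  refine Eq.trans ?_ (map_orderedMonomial (MonoidHom.fst _ _) y k).symm
  change Multiplicative.ofAdd k = orderedMonomial (fun i => Multiplicative.ofAdd (Pi.single i 1)) k
  rw [orderedMonomial, List.prod_ofFn]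
  simp only [← ofAdd_zsmul, ← ofAdd_sum]
  congr 1
  ext j
  simp [Finset.sum_apply, Pi.single_apply]

end QuantumTorus

/-- If `R` is a commutative Noetherian integral domain, then the quantum
torus `T(Q)` is a Noetherian ring with no zero divisors (a Noetherian domain). -/
theorem quantumTorus_noetherian_domain (R : Type) [CommRing R] [IsDomain R]
    [IsNoetherianRing R] (sqq : Rˣ) {r : ℕ} (Q : Matrix (Fin r) (Fin r) ℤ)
    (hQ : Qᵀ = -Q) :
    IsNoetherianRing (QuantumTorus R sqq Q) ∧ NoZeroDivisors (QuantumTorus R sqq Q) := by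
  have hcomm := QuantumTorus.commutator_unitX_mem (R := R) sqq Q
  have hgen := QuantumTorus.unitsAdjoin_unitX (R := R) sqq Q
  exact ⟨isNoetherianRing_of_quasiCommuting _ hcomm hgen,
    noZeroDivisors_of_homogeneous (QuantumTorus.rep sqq hQ) _
      (QuantumTorus.orderedMonomial_mem_homogeneousUnits sqq hQ)
      (span_orderedMonomial_eq_top _ hcomm hgen)⟩
end

section
/- Let R be a commutative Noetherian integral domain with a distinguished invertible element q^{1/2} (write q = (q^{1/2})^2), and let O_{q²}(sl₂) be the R-algebra with generators a, b, c, d and relations ca = q²ac, db = q²bd, ba = q²ab, dc = q²cd, bc = cb, ad − q^{−2}bc = 1, and da − q²bc = 1. Then O_{q²}(sl₂) is a Noetherian ring and has no zero divisors (i.e., it is a Noetherian domain). -/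
/-- Defining relations of `O_{q²}(sl₂)` over a commutative ring `R` with
distinguished invertible element `sqq = q^{1/2}` (so `q = sqq^2`, `q² = sqq^4`):
generators `a = ι 0`, `b = ι 1`, `c = ι 2`, `d = ι 3` and relations
`ca = q²ac`, `db = q²bd`, `ba = q²ab`, `dc = q²cd`, `bc = cb`,
`ad − q^{−2}bc = 1`, `da − q²bc = 1`. -/
inductive OSL2Rel (R : Type) [CommRing R] (sqq : Rˣ) :
    FreeAlgebra R (Fin 4) → FreeAlgebra R (Fin 4) → Prop
  | ca : OSL2Rel R sqq (FreeAlgebra.ι R 2 * FreeAlgebra.ι R 0)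
      (((sqq ^ (4 : ℤ) : Rˣ) : R) • (FreeAlgebra.ι R 0 * FreeAlgebra.ι R 2))
  | db : OSL2Rel R sqq (FreeAlgebra.ι R 3 * FreeAlgebra.ι R 1)
      (((sqq ^ (4 : ℤ) : Rˣ) : R) • (FreeAlgebra.ι R 1 * FreeAlgebra.ι R 3))
  | ba : OSL2Rel R sqq (FreeAlgebra.ι R 1 * FreeAlgebra.ι R 0)
      (((sqq ^ (4 : ℤ) : Rˣ) : R) • (FreeAlgebra.ι R 0 * FreeAlgebra.ι R 1))
  | dc : OSL2Rel R sqq (FreeAlgebra.ι R 3 * FreeAlgebra.ι R 2)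
      (((sqq ^ (4 : ℤ) : Rˣ) : R) • (FreeAlgebra.ι R 2 * FreeAlgebra.ι R 3))
  | bc : OSL2Rel R sqq (FreeAlgebra.ι R 1 * FreeAlgebra.ι R 2)
      (FreeAlgebra.ι R 2 * FreeAlgebra.ι R 1)
  | ad : OSL2Rel R sqq
      (FreeAlgebra.ι R 0 * FreeAlgebra.ι R 3 -
        ((sqq ^ (-4 : ℤ) : Rˣ) : R) • (FreeAlgebra.ι R 1 * FreeAlgebra.ι R 2)) 1
  | da : OSL2Rel R sqq
      (FreeAlgebra.ι R 3 * FreeAlgebra.ι R 0 -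
        ((sqq ^ (4 : ℤ) : Rˣ) : R) • (FreeAlgebra.ι R 1 * FreeAlgebra.ι R 2)) 1

/-- The quantized coordinate algebra `O_{q²}(sl₂)`. -/
def OqSL2 (R : Type) [CommRing R] (sqq : Rˣ) : Type := RingQuot (OSL2Rel R sqq)

noncomputable instance (R : Type) [CommRing R] (sqq : Rˣ) : Ring (OqSL2 R sqq) :=
  inferInstanceAs (Ring (RingQuot (OSL2Rel R sqq)))

noncomputable instance (R : Type) [CommRing R] (sqq : Rˣ) : Algebra R (OqSL2 R sqq) :=
  inferInstanceAs (Algebra R (RingQuot (OSL2Rel R sqq)))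

namespace OqSL2

variable (R : Type) [CommRing R] (sqq : Rˣ)

noncomputable def a : OqSL2 R sqq := RingQuot.mkAlgHom R (OSL2Rel R sqq) (FreeAlgebra.ι R 0)
noncomputable def b : OqSL2 R sqq := RingQuot.mkAlgHom R (OSL2Rel R sqq) (FreeAlgebra.ι R 1)
noncomputable def c : OqSL2 R sqq := RingQuot.mkAlgHom R (OSL2Rel R sqq) (FreeAlgebra.ι R 2)
noncomputable def d : OqSL2 R sqq := RingQuot.mkAlgHom R (OSL2Rel R sqq) (FreeAlgebra.ι R 3)

/-- The candidate basis monomials of `O_{q²}(sl₂)`: `a^i b^j c^k` for `i,j,k ≥ 0`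
(indexed by `Sum.inl (i,j,k)`) together with `d^l b^j c^k` for `l ≥ 1`, `j,k ≥ 0`
(indexed by `Sum.inr (l',j,k)` with `l = l' + 1`). -/
noncomputable def basisMonomial : (ℕ × ℕ × ℕ) ⊕ (ℕ × ℕ × ℕ) → OqSL2 R sqq
  | Sum.inl (i, j, k) => a R sqq ^ i * b R sqq ^ j * c R sqq ^ k
  | Sum.inr (l, j, k) => d R sqq ^ (l + 1) * b R sqq ^ j * c R sqq ^ k

end OqSL2

section OreExtension

variable {B S : Type*} [Ring B] [Ring S] (f : B →+* S) (x : S)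

/-- The additive subgroup of elements `∑ i < n, f bᵢ * x ^ i`. -/
def oreFiltration (n : ℕ) : AddSubgroup S :=
  AddSubgroup.closure {y | ∃ i < n, ∃ b, f b * x ^ i = y}

variable {f x}

theorem mul_pow_mem_oreFiltration {i n : ℕ} (h : i < n) (b : B) :
    f b * x ^ i ∈ oreFiltration f x n :=
  AddSubgroup.subset_closure ⟨i, h, b, rfl⟩

theorem oreFiltration_mono : Monotone (oreFiltration f x) := fun _ _ h =>
  AddSubgroup.closure_mono fun _ ⟨i, hi, b, hb⟩ => ⟨i, hi.trans_le h, b, hb⟩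

theorem oreFiltration_zero : oreFiltration f x 0 = ⊥ := by
  simp [oreFiltration]

theorem left_mul_mem_oreFiltration {n : ℕ} {y : S} (hy : y ∈ oreFiltration f x n) (b : B) :
    f b * y ∈ oreFiltration f x n := by
  induction hy using AddSubgroup.closure_induction with
  | mem y hy =>
    obtain ⟨i, hi, c, rfl⟩ := hy
    rw [← mul_assoc, ← map_mul]
    exact mul_pow_mem_oreFiltration hi _
  | zero => simp
  | add y z _ _ hy hz => rw [mul_add]; exact add_mem hy hz
  | neg y _ hy => rw [mul_neg]; exact neg_mem hy

theorem gen_mul_mem_oreFiltration (hl : ∀ b, ∃ b' b'', x * f b = f b' * x + f b'') {n : ℕ} {y : S}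
    (hy : y ∈ oreFiltration f x n) : x * y ∈ oreFiltration f x (n + 1) := by
  induction hy using AddSubgroup.closure_induction with
  | mem y hy =>
    obtain ⟨i, hi, c, rfl⟩ := hy
    obtain ⟨b', b'', h⟩ := hl c
    rw [← mul_assoc, h, add_mul, mul_assoc, ← pow_succ']
    exact add_mem (mul_pow_mem_oreFiltration (by lia) _) (mul_pow_mem_oreFiltration (by lia) _)
  | zero => simp
  | add y z _ _ hy hz => rw [mul_add]; exact add_mem hy hz
  | neg y _ hy => rw [mul_neg]; exact neg_mem hy

theorem pow_mul_mem_oreFiltration (hl : ∀ b, ∃ b' b'', x * f b = f b' * x + f b'') (n : ℕ) (b : B) :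
    x ^ n * f b ∈ oreFiltration f x (n + 1) := by
  induction n with
  | zero => simpa using mul_pow_mem_oreFiltration (f := f) (x := x) zero_lt_one b
  | succ n ih =>
    rw [pow_succ', mul_assoc]
    exact gen_mul_mem_oreFiltration hl ih

theorem right_mul_mem_oreFiltration (hl : ∀ b, ∃ b' b'', x * f b = f b' * x + f b'') {n : ℕ}
    {y : S} (hy : y ∈ oreFiltration f x n) (b : B) : y * f b ∈ oreFiltration f x n := by
  induction hy using AddSubgroup.closure_induction with
  | mem y hy =>
    obtain ⟨i, hi, c, rfl⟩ := hy
    rw [mul_assoc]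
    exact left_mul_mem_oreFiltration
      (oreFiltration_mono hi (pow_mul_mem_oreFiltration hl i b)) c
  | zero => simp
  | add y z _ _ hy hz => rw [add_mul]; exact add_mem hy hz
  | neg y _ hy => rw [neg_mul]; exact neg_mem hy

theorem exists_pow_mul_sub_mem_oreFiltration (hl : ∀ b, ∃ b' b'', x * f b = f b' * x + f b'')
    (n : ℕ) (b : B) : ∃ b', x ^ n * f b - f b' * x ^ n ∈ oreFiltration f x n := by
  induction n with
  | zero => exact ⟨b, by simp⟩
  | succ n ih =>
    obtain ⟨c, hc⟩ := ih
    obtain ⟨b', b'', h⟩ := hl c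
    refine ⟨b', ?_⟩
    have : x ^ (n + 1) * f b - f b' * x ^ (n + 1) =
        x * (x ^ n * f b - f c * x ^ n) + f b'' * x ^ n := by
      rw [mul_sub, ← mul_assoc x (f c), h]
      simp only [pow_succ']
      noncomm_ring
    rw [this]
    exact add_mem (gen_mul_mem_oreFiltration hl hc) (mul_pow_mem_oreFiltration n.lt_succ_self _)

theorem exists_mul_pow_sub_mem_oreFiltration (hl : ∀ b, ∃ b' b'', x * f b = f b' * x + f b'')
    (hr : ∀ b, ∃ b' b'', f b * x = x * f b' + f b'')
    (n : ℕ) (b : B) : ∃ b', f b * x ^ n - x ^ n * f b' ∈ oreFiltration f x n := by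
  induction n generalizing b with
  | zero => exact ⟨b, by simp⟩
  | succ n ih =>
    obtain ⟨b', b'', h⟩ := hr b
    obtain ⟨c, hc⟩ := ih b'
    refine ⟨c, ?_⟩
    have : f b * x ^ (n + 1) - x ^ (n + 1) * f c =
        x * (f b' * x ^ n - x ^ n * f c) + f b'' * x ^ n := by
      rw [pow_succ', ← mul_assoc (f b), h]
      noncomm_ring
    rw [this]
    exact add_mem (gen_mul_mem_oreFiltration hl hc) (mul_pow_mem_oreFiltration n.lt_succ_self _)

theorem exists_sub_mem_oreFiltration (hl : ∀ b, ∃ b' b'', x * f b = f b' * x + f b'')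
    (hr : ∀ b, ∃ b' b'', f b * x = x * f b' + f b'') {n : ℕ} {y : S}
    (hy : y ∈ oreFiltration f x (n + 1)) : ∃ b, y - x ^ n * f b ∈ oreFiltration f x n := by
  induction hy using AddSubgroup.closure_induction with
  | mem y hy =>
    obtain ⟨i, hi, c, rfl⟩ := hy
    obtain rfl | h := (Nat.le_of_lt_succ hi).eq_or_lt
    · exact exists_mul_pow_sub_mem_oreFiltration hl hr i c
    · exact ⟨0, by simpa using mul_pow_mem_oreFiltration h c⟩
  | zero => exact ⟨0, by simp⟩
  | add y z _ _ hy hz =>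
    obtain ⟨b, hb⟩ := hy
    obtain ⟨c, hc⟩ := hz
    refine ⟨b + c, ?_⟩
    rw [map_add, mul_add, add_sub_add_comm]
    exact add_mem hb hc
  | neg y _ hy =>
    obtain ⟨b, hb⟩ := hy
    refine ⟨-b, ?_⟩
    rw [map_neg, mul_neg, ← neg_sub']
    exact neg_mem hb

/-- The left ideal of the coefficients `b` of the leading terms `x ^ n * f b` of the elements
of degree at most `n` of a left ideal `I`. -/
def oreLeadingCoeff (hl : ∀ b, ∃ b' b'', x * f b = f b' * x + f b'') (I : Ideal S) (n : ℕ) :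
    Ideal B where
  carrier := {b | ∃ y ∈ oreFiltration f x n, x ^ n * f b + y ∈ I}
  zero_mem' := ⟨0, zero_mem _, by simp⟩
  add_mem' := by
    rintro b c ⟨y, hy, hb⟩ ⟨z, hz, hc⟩
    refine ⟨y + z, add_mem hy hz, ?_⟩
    rw [map_add, mul_add, add_add_add_comm]
    exact add_mem hb hc
  smul_mem' := by
    rintro c b ⟨y, hy, hb⟩
    obtain ⟨c', hc'⟩ := exists_pow_mul_sub_mem_oreFiltration hl n c
    refine ⟨f c' * y - (x ^ n * f c - f c' * x ^ n) * f b,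
      sub_mem (left_mul_mem_oreFiltration hy _) (right_mul_mem_oreFiltration hl hc' _), ?_⟩
    have : x ^ n * f (c • b) + (f c' * y - (x ^ n * f c - f c' * x ^ n) * f b) =
        f c' * (x ^ n * f b + y) := by
      rw [smul_eq_mul, map_mul]
      noncomm_ring
    rw [this]
    exact I.mul_mem_left _ hb

theorem oreLeadingCoeff_mono_left (hl : ∀ b, ∃ b' b'', x * f b = f b' * x + f b'') (n : ℕ) :
    Monotone (oreLeadingCoeff hl · n) :=
  fun _ _ h _ ⟨y, hy, hb⟩ => ⟨y, hy, h hb⟩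

theorem oreLeadingCoeff_mono_right (hl : ∀ b, ∃ b' b'', x * f b = f b' * x + f b'')
    (I : Ideal S) : Monotone (oreLeadingCoeff hl I) :=
  monotone_nat_of_le_succ fun n _ ⟨y, hy, hb⟩ =>
    ⟨x * y, gen_mul_mem_oreFiltration hl hy, by
      rw [pow_succ', mul_assoc, ← mul_add]
      exact I.mul_mem_left _ hb⟩

theorem mem_of_oreLeadingCoeff_le (hl : ∀ b, ∃ b' b'', x * f b = f b' * x + f b'')
    (hr : ∀ b, ∃ b' b'', f b * x = x * f b' + f b'') {I J : Ideal S} (hIJ : I ≤ J)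
    (h : ∀ n, oreLeadingCoeff hl J n ≤ oreLeadingCoeff hl I n) {n : ℕ} {y : S}
    (hy : y ∈ oreFiltration f x n) (hyJ : y ∈ J) : y ∈ I := by
  induction n generalizing y with
  | zero =>
    rw [oreFiltration_zero, AddSubgroup.mem_bot] at hy
    simp [hy]
  | succ n ih =>
    obtain ⟨b, hb⟩ := exists_sub_mem_oreFiltration hl hr hy
    obtain ⟨z, hz, hzI⟩ := h n (show b ∈ oreLeadingCoeff hl J n from
      ⟨_, hb, by rwa [add_sub_cancel]⟩)
    have key : y - (x ^ n * f b + z) ∈ I :=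
      ih (by rw [← sub_sub]; exact sub_mem hb hz) (sub_mem hyJ (hIJ hzI))
    simpa using add_mem key hzI

/-- **Hilbert's basis theorem** for a ring generated over a left Noetherian ring by one element
`x` that quasi-commutes with the coefficients. -/
theorem isNoetherianRing_of_ore [IsNoetherianRing B]
    (hl : ∀ b, ∃ b' b'', x * f b = f b' * x + f b'')
    (hr : ∀ b, ∃ b' b'', f b * x = x * f b' + f b'')
    (hgen : ∀ V : AddSubgroup S, 1 ∈ V → (∀ b, ∀ v ∈ V, f b * v ∈ V) → (∀ v ∈ V, x * v ∈ V) →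
      V = ⊤) :
    IsNoetherianRing S := by
  have hdir : Directed (· ≤ ·) (oreFiltration f x) := oreFiltration_mono.directed_le
  have htop : ∀ y, ∃ n, y ∈ oreFiltration f x n := fun y => by
    rw [← AddSubgroup.mem_iSup_of_directed hdir, hgen (⨆ n, oreFiltration f x n)]
    · trivial
    · refine AddSubgroup.mem_iSup_of_mem 1 ?_
      simpa using mul_pow_mem_oreFiltration (f := f) (x := x) zero_lt_one 1
    · intro b v hv
      obtain ⟨n, hn⟩ := (AddSubgroup.mem_iSup_of_directed hdir).1 hv
      exact AddSubgroup.mem_iSup_of_mem n (left_mul_mem_oreFiltration hn b)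
    · intro v hv
      obtain ⟨n, hn⟩ := (AddSubgroup.mem_iSup_of_directed hdir).1 hv
      exact AddSubgroup.mem_iSup_of_mem (n + 1) (gen_mul_mem_oreFiltration hl hn)
  refine monotone_stabilizes_iff_noetherian.1 fun I => ?_
  have hstab := monotone_stabilizes_iff_noetherian.2 ‹IsNoetherianRing B›
  obtain ⟨N, hN⟩ : ∃ N, ∀ m, N ≤ m →
      oreLeadingCoeff hl (I N) N = oreLeadingCoeff hl (I m) m :=
    hstab ⟨fun k => oreLeadingCoeff hl (I k) k, fun k l hkl =>
    (oreLeadingCoeff_mono_left hl k (I.monotone hkl)).trans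
      (oreLeadingCoeff_mono_right hl (I l) hkl)⟩
  choose M hM using fun n => show ∃ M, ∀ m, M ≤ m →
      oreLeadingCoeff hl (I M) n = oreLeadingCoeff hl (I m) n from
    hstab ⟨fun k => oreLeadingCoeff hl (I k) n, fun k l hkl =>
    oreLeadingCoeff_mono_left hl n (I.monotone hkl)⟩
  refine ⟨N + ∑ n ∈ Finset.range N, M n, fun m hm => le_antisymm (I.monotone hm) fun y hy => ?_⟩
  obtain ⟨k, hk⟩ := htop y
  refine mem_of_oreLeadingCoeff_le hl hr (I.monotone hm) (fun n => ?_) hk hy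
  obtain hn | hn := lt_or_ge n N
  · have : M n ≤ ∑ n ∈ Finset.range N, M n :=
      Finset.single_le_sum (fun _ _ => Nat.zero_le _) (Finset.mem_range.2 hn)
    rw [← hM n m (by lia), ← hM n (N + _) (by lia)]
  · calc
      oreLeadingCoeff hl (I m) n ≤ oreLeadingCoeff hl (I (max m n)) (max m n) :=
        (oreLeadingCoeff_mono_left hl n (I.monotone (le_max_left m n))).trans
          (oreLeadingCoeff_mono_right hl _ (le_max_right m n))
      _ = oreLeadingCoeff hl (I N) N := (hN _ (by lia)).symm
      _ ≤ _ := (oreLeadingCoeff_mono_left hl N (I.monotone (by lia))).trans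
        (oreLeadingCoeff_mono_right hl _ hn)

end OreExtension

section SkewMonoidAlgebra

variable {k G : Type*} [Semiring k] [Group G] [MulSemiringAction G k]

theorem SkewMonoidAlgebra.noZeroDivisors [NoZeroDivisors k] [UniqueProds G] :
    NoZeroDivisors (SkewMonoidAlgebra k G) where
  eq_zero_or_eq_zero_of_mul_eq_zero {f g} hfg := by
    classical
    contrapose! hfg
    simp only [ne_eq, ← SkewMonoidAlgebra.coeff_eq_zero, ← Finsupp.support_nonempty_iff] at hfg
    obtain ⟨a, ha, b, hb, h⟩ := UniqueProds.uniqueMul_of_nonempty hfg.1 hfg.2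
    have key : (f * g).coeff (a * b) = f.coeff a * a • g.coeff b := by
      simp_rw [SkewMonoidAlgebra.coeff_mul, SkewMonoidAlgebra.sum_def, Finsupp.sum,
        ← Finset.sum_product']
      refine (Finset.sum_eq_single (a, b) ?_ ?_).trans (if_pos rfl)
      · intro ab hab hne
        rw [Finset.mem_product] at hab
        exact if_neg fun he => hne (Prod.ext (h hab.1 hab.2 he).1 (h hab.1 hab.2 he).2)
      · exact fun hn => absurd (Finset.mk_mem_product ha hb) hn
    rw [Finsupp.mem_support_iff] at ha hb
    intro h0
    rw [h0, SkewMonoidAlgebra.coeff_zero, Finsupp.zero_apply, eq_comm] at key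
    exact (mul_ne_zero ha ((smul_ne_zero_iff_ne a).2 hb)) key

theorem SkewMonoidAlgebra.exists_single_pow [Nontrivial k] [NoZeroDivisors k] (g : G) {v : k}
    (hv : v ≠ 0) (n : ℕ) :
    ∃ u : k, u ≠ 0 ∧ SkewMonoidAlgebra.single g v ^ n = SkewMonoidAlgebra.single (g ^ n) u := by
  induction n with
  | zero => exact ⟨1, one_ne_zero, by rw [pow_zero, pow_zero, SkewMonoidAlgebra.one_def]⟩
  | succ n ih =>
    obtain ⟨u, hu, h⟩ := ih
    refine ⟨v * g • u, mul_ne_zero hv ((smul_ne_zero_iff_ne g).2 hu), ?_⟩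
    rw [pow_succ', h, SkewMonoidAlgebra.single_mul_single, pow_succ']

end SkewMonoidAlgebra

open scoped IsMulCommutative in
/-- The algebra homomorphism from a polynomial ring determined by two commuting elements. -/
theorem MvPolynomial.exists_algHom_of_commute {R A : Type*} [CommRing R] [Ring A] [Algebra R A]
    {y z : A} (h : Commute y z) :
    ∃ f : MvPolynomial (Fin 2) R →ₐ[R] A, f (X 0) = y ∧ f (X 1) = z := by
  have hc : ∀ u ∈ ({y, z} : Set A), ∀ v ∈ ({y, z} : Set A), u * v = v * u := by
    rintro u (rfl | rfl) v (rfl | rfl)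
    exacts [rfl, h.eq, h.eq.symm, rfl]
  have := Algebra.isMulCommutative_adjoin R hc
  let y' : Algebra.adjoin R ({y, z} : Set A) := ⟨y, Algebra.subset_adjoin (by simp)⟩
  let z' : Algebra.adjoin R ({y, z} : Set A) := ⟨z, Algebra.subset_adjoin (by simp)⟩
  refine ⟨(Algebra.adjoin R ({y, z} : Set A)).val.comp (MvPolynomial.aeval ![y', z']), ?_, ?_⟩
  · simp [y']
  · simp [z']

namespace MvPolynomial

variable {R σ : Type*} [CommRing R]

/-- The automorphism of a polynomial ring that scales every variable by a unit. -/
noncomputable def scaleVars (u : Rˣ) : MvPolynomial σ R ≃ₐ[R] MvPolynomial σ R :=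
  AlgEquiv.ofAlgHom (aeval fun i => (u : R) • X i) (aeval fun i => ((u⁻¹ : Rˣ) : R) • X i)
    (by ext; simp [smul_smul]) (by ext; simp [smul_smul])

theorem scaleVars_X (u : Rˣ) (i : σ) : scaleVars u (X i) = (u : R) • X i := by
  simp [scaleVars]

/-- The action of the infinite cyclic group by powers of `scaleVars u`. -/
@[reducible] noncomputable def scaleAction (u : Rˣ) :
    MulSemiringAction (Multiplicative ℤ) (MvPolynomial σ R) :=
  MulSemiringAction.compHom _ (zpowersHom (MvPolynomial σ R ≃ₐ[R] MvPolynomial σ R) (scaleVars u))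

theorem intertwines_of_X {A : Type*} [Ring A] [Algebra R A] (ι : MvPolynomial σ R →ₐ[R] A)
    (τ : MvPolynomial σ R →ₐ[R] MvPolynomial σ R) {x : A}
    (h : ∀ i, x * ι (X i) = ι (τ (X i)) * x) (p : MvPolynomial σ R) :
    x * ι p = ι (τ p) * x := by
  induction p using MvPolynomial.induction_on with
  | C r =>
    rw [← algebraMap_eq, AlgHom.commutes, AlgHom.commutes, AlgHom.commutes, Algebra.commutes]
  | add p q hp hq => simp only [map_add, mul_add, add_mul, hp, hq]
  | mul_X p i hp => rw [map_mul, map_mul, map_mul, ← mul_assoc, hp, mul_assoc, h, mul_assoc]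

end MvPolynomial

namespace OqSL2

variable (R : Type) [CommRing R] (sqq : Rˣ)

/-- The unit `q²`. -/
abbrev qSq {R : Type} [CommRing R] (sqq : Rˣ) : Rˣ := sqq ^ (4 : ℤ)

/-- The quotient map from the free algebra. -/
noncomputable def mk : FreeAlgebra R (Fin 4) →ₐ[R] OqSL2 R sqq :=
  RingQuot.mkAlgHom R (OSL2Rel R sqq)

variable {R} {sqq}

theorem mk_eq_of_rel {y z : FreeAlgebra R (Fin 4)} (h : OSL2Rel R sqq y z) :
    mk R sqq y = mk R sqq z :=
  RingQuot.mkAlgHom_rel R h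

theorem c_mul_a : c R sqq * a R sqq = (qSq sqq : R) • (a R sqq * c R sqq) := by
  have h := mk_eq_of_rel (OSL2Rel.ca (R := R) (sqq := sqq))
  rw [map_smul, map_mul, map_mul] at h
  exact h

theorem d_mul_b : d R sqq * b R sqq = (qSq sqq : R) • (b R sqq * d R sqq) := by
  have h := mk_eq_of_rel (OSL2Rel.db (R := R) (sqq := sqq))
  rw [map_smul, map_mul, map_mul] at h
  exact h

theorem b_mul_a : b R sqq * a R sqq = (qSq sqq : R) • (a R sqq * b R sqq) := by
  have h := mk_eq_of_rel (OSL2Rel.ba (R := R) (sqq := sqq))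
  rw [map_smul, map_mul, map_mul] at h
  exact h

theorem d_mul_c : d R sqq * c R sqq = (qSq sqq : R) • (c R sqq * d R sqq) := by
  have h := mk_eq_of_rel (OSL2Rel.dc (R := R) (sqq := sqq))
  rw [map_smul, map_mul, map_mul] at h
  exact h

theorem commute_b_c : Commute (b R sqq) (c R sqq) := by
  have h := mk_eq_of_rel (OSL2Rel.bc (R := R) (sqq := sqq))
  rw [map_mul, map_mul] at h
  exact h

theorem a_mul_d : a R sqq * d R sqq = 1 + ((qSq sqq)⁻¹ : Rˣ).1 • (b R sqq * c R sqq) := by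
  have h := mk_eq_of_rel (OSL2Rel.ad (R := R) (sqq := sqq))
  rw [map_sub, map_one, map_smul, map_mul, map_mul, sub_eq_iff_eq_add, zpow_neg] at h
  exact h

theorem d_mul_a : d R sqq * a R sqq = 1 + (qSq sqq : R) • (b R sqq * c R sqq) := by
  have h := mk_eq_of_rel (OSL2Rel.da (R := R) (sqq := sqq))
  rw [map_sub, map_one, map_smul, map_mul, map_mul, sub_eq_iff_eq_add] at h
  exact h

theorem a_mul_b : a R sqq * b R sqq = ((qSq sqq)⁻¹ : Rˣ).1 • (b R sqq * a R sqq) := by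
  rw [b_mul_a, smul_smul, Units.inv_mul, one_smul]

theorem a_mul_c : a R sqq * c R sqq = ((qSq sqq)⁻¹ : Rˣ).1 • (c R sqq * a R sqq) := by
  rw [c_mul_a, smul_smul, Units.inv_mul, one_smul]

/-- An additive subgroup that contains `1` and is stable under left multiplication by scalars and
by the generators is everything. -/
theorem eq_top_of_mul_mem (V : AddSubgroup (OqSL2 R sqq)) (h1 : 1 ∈ V)
    (hR : ∀ r : R, ∀ v ∈ V, algebraMap R _ r * v ∈ V) (ha : ∀ v ∈ V, a R sqq * v ∈ V)
    (hb : ∀ v ∈ V, b R sqq * v ∈ V) (hc : ∀ v ∈ V, c R sqq * v ∈ V)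
    (hd : ∀ v ∈ V, d R sqq * v ∈ V) : V = ⊤ := by
  have key : ∀ z : FreeAlgebra R (Fin 4), ∀ v ∈ V, mk R sqq z * v ∈ V := by
    intro z
    induction z using FreeAlgebra.induction with
    | grade0 r => rw [AlgHom.commutes]; exact hR r
    | grade1 i =>
      fin_cases i
      exacts [ha, hb, hc, hd]
    | mul y z hy hz =>
      intro v hv
      rw [map_mul, mul_assoc]
      exact hy _ (hz v hv)
    | add y z hy hz =>
      intro v hv
      rw [map_add, add_mul]
      exact add_mem (hy v hv) (hz v hv)
  refine (AddSubgroup.eq_top_iff' V).2 fun y => ?_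
  obtain ⟨z, rfl⟩ : ∃ z, mk R sqq z = y := RingQuot.mkAlgHom_surjective R (OSL2Rel R sqq) y
  simpa using key z 1 h1

open MvPolynomial

section Noetherian

variable {ι : MvPolynomial (Fin 2) R →ₐ[R] OqSL2 R sqq}

theorem a_mul_eq (hb : ι (X 0) = b R sqq) (hc : ι (X 1) = c R sqq) (p : MvPolynomial (Fin 2) R) :
    a R sqq * ι p = ι (scaleVars (qSq sqq)⁻¹ p) * a R sqq := by
  refine intertwines_of_X ι (scaleVars (qSq sqq)⁻¹).toAlgHom (fun i => ?_) p
  fin_cases i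
  · simp [scaleVars_X, hb, a_mul_b]
  · simp [scaleVars_X, hc, a_mul_c]

theorem d_mul_eq (hb : ι (X 0) = b R sqq) (hc : ι (X 1) = c R sqq) (p : MvPolynomial (Fin 2) R) :
    d R sqq * ι p = ι (scaleVars (qSq sqq) p) * d R sqq := by
  refine intertwines_of_X ι (scaleVars (qSq sqq)).toAlgHom (fun i => ?_) p
  fin_cases i
  · simp [scaleVars_X, hb, d_mul_b]
  · simp [scaleVars_X, hc, d_mul_c]

variable (R sqq)

/-- The subalgebra generated by `a`, `b` and `c`. -/
noncomputable def adjoinABC : Subalgebra R (OqSL2 R sqq) :=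
  Algebra.adjoin R {a R sqq, b R sqq, c R sqq}

variable {R sqq}

theorem a_mem_adjoinABC : a R sqq ∈ adjoinABC R sqq := Algebra.subset_adjoin (by simp)

theorem b_mem_adjoinABC : b R sqq ∈ adjoinABC R sqq := Algebra.subset_adjoin (by simp)

theorem c_mem_adjoinABC : c R sqq ∈ adjoinABC R sqq := Algebra.subset_adjoin (by simp)

theorem mem_adjoinABC_of_X (hb : ι (X 0) = b R sqq) (hc : ι (X 1) = c R sqq)
    (p : MvPolynomial (Fin 2) R) : ι p ∈ adjoinABC R sqq := by
  induction p using MvPolynomial.induction_on with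
  | C r =>
    rw [← algebraMap_eq, AlgHom.commutes]
    exact Subalgebra.algebraMap_mem _ r
  | add p q hp hq => rw [map_add]; exact add_mem hp hq
  | mul_X p i hp =>
    rw [map_mul]
    refine mul_mem hp ?_
    fin_cases i
    · exact hb ▸ b_mem_adjoinABC
    · exact hc ▸ c_mem_adjoinABC

theorem isNoetherianRing_adjoinABC [IsNoetherianRing R] :
    IsNoetherianRing (adjoinABC R sqq) := by
  obtain ⟨ι, hb, hc⟩ := MvPolynomial.exists_algHom_of_commute (R := R) (commute_b_c (sqq := sqq))
  let f := ι.codRestrict (adjoinABC R sqq) (mem_adjoinABC_of_X hb hc)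
  have hl : ∀ p, (⟨a R sqq, a_mem_adjoinABC⟩ : adjoinABC R sqq) * f p =
      f (scaleVars (qSq sqq)⁻¹ p) * ⟨a R sqq, a_mem_adjoinABC⟩ :=
    fun p => Subtype.ext (a_mul_eq hb hc p)
  refine isNoetherianRing_of_ore (f := (f : MvPolynomial (Fin 2) R →+* adjoinABC R sqq))
    (x := ⟨a R sqq, a_mem_adjoinABC⟩) (fun p => ⟨_, 0, by simpa using hl p⟩)
    (fun p => ⟨(scaleVars (qSq sqq)⁻¹).symm p, 0, by
      simpa using (hl ((scaleVars (qSq sqq)⁻¹).symm p)).symm⟩)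
    fun V h1 hf ha => ?_
  have key : ∀ y (hy : y ∈ adjoinABC R sqq), ∀ v ∈ V, (⟨y, hy⟩ : adjoinABC R sqq) * v ∈ V := by
    intro y hy
    induction hy using Algebra.adjoin_induction with
    | mem y hy =>
      obtain rfl | rfl | rfl := hy
      · exact ha
      · intro v hv
        convert hf (X 0) v hv
        exact Subtype.ext hb.symm
      · intro v hv
        convert hf (X 1) v hv
        exact Subtype.ext hc.symm
    | algebraMap r =>
      intro v hv
      convert hf (C r) v hv
      exact Subtype.ext (ι.commutes r).symm
    | add y z hy hz ihy ihz =>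
      intro v hv
      convert add_mem (ihy v hv) (ihz v hv)
      rw [← add_mul]
      rfl
    | mul y z hy hz ihy ihz =>
      intro v hv
      convert ihy _ (ihz v hv) using 1
      rw [← mul_assoc]
      rfl
  refine (AddSubgroup.eq_top_iff' V).2 fun y => ?_
  simpa using key y y.2 1 h1

theorem d_mul_mem_adjoinABC {y : OqSL2 R sqq} (hy : y ∈ adjoinABC R sqq) :
    ∃ y' ∈ adjoinABC R sqq, ∃ y'' ∈ adjoinABC R sqq, d R sqq * y = y' * d R sqq + y'' := by
  induction hy using Algebra.adjoin_induction with
  | mem y hy =>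
    obtain rfl | rfl | rfl := hy
    · refine ⟨0, zero_mem _, _, ?_, by rw [d_mul_a, zero_mul, zero_add]⟩
      exact add_mem (one_mem _)
        (Subalgebra.smul_mem _ (mul_mem b_mem_adjoinABC c_mem_adjoinABC) _)
    · exact ⟨_, Subalgebra.smul_mem _ b_mem_adjoinABC _, 0, zero_mem _,
        by rw [d_mul_b, add_zero, smul_mul_assoc]⟩
    · exact ⟨_, Subalgebra.smul_mem _ c_mem_adjoinABC _, 0, zero_mem _,
        by rw [d_mul_c, add_zero, smul_mul_assoc]⟩
  | algebraMap r =>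
    exact ⟨_, Subalgebra.algebraMap_mem _ r, 0, zero_mem _,
      by rw [add_zero, Algebra.commutes]⟩
  | add y z _ _ hy hz =>
    obtain ⟨y', hy', y'', hy'', h⟩ := hy
    obtain ⟨z', hz', z'', hz'', h'⟩ := hz
    refine ⟨_, add_mem hy' hz', _, add_mem hy'' hz'', ?_⟩
    rw [mul_add, h, h']
    noncomm_ring
  | mul y z _ hz hy ihz =>
    obtain ⟨y', hy', y'', hy'', h⟩ := hy
    obtain ⟨z', hz', z'', hz'', h'⟩ := ihz
    refine ⟨_, mul_mem hy' hz', _, add_mem (mul_mem hy' hz'') (mul_mem hy'' hz), ?_⟩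
    rw [← mul_assoc, h, add_mul, mul_assoc, h']
    noncomm_ring

theorem mul_d_mem_adjoinABC {y : OqSL2 R sqq} (hy : y ∈ adjoinABC R sqq) :
    ∃ y' ∈ adjoinABC R sqq, ∃ y'' ∈ adjoinABC R sqq, y * d R sqq = d R sqq * y' + y'' := by
  induction hy using Algebra.adjoin_induction with
  | mem y hy =>
    obtain rfl | rfl | rfl := hy
    · refine ⟨0, zero_mem _, _, ?_, by rw [a_mul_d, mul_zero, zero_add]⟩
      exact add_mem (one_mem _)
        (Subalgebra.smul_mem _ (mul_mem b_mem_adjoinABC c_mem_adjoinABC) _)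
    · refine ⟨_, Subalgebra.smul_mem _ b_mem_adjoinABC ((qSq sqq)⁻¹ : Rˣ).1, 0, zero_mem _, ?_⟩
      rw [mul_smul_comm, d_mul_b, smul_smul, Units.inv_mul, one_smul, add_zero]
    · refine ⟨_, Subalgebra.smul_mem _ c_mem_adjoinABC ((qSq sqq)⁻¹ : Rˣ).1, 0, zero_mem _, ?_⟩
      rw [mul_smul_comm, d_mul_c, smul_smul, Units.inv_mul, one_smul, add_zero]
  | algebraMap r =>
    exact ⟨_, Subalgebra.algebraMap_mem _ r, 0, zero_mem _,
      by rw [add_zero, Algebra.commutes]⟩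
  | add y z _ _ hy hz =>
    obtain ⟨y', hy', y'', hy'', h⟩ := hy
    obtain ⟨z', hz', z'', hz'', h'⟩ := hz
    refine ⟨_, add_mem hy' hz', _, add_mem hy'' hz'', ?_⟩
    rw [add_mul, h, h']
    noncomm_ring
  | mul y z hy _ ihy hz =>
    obtain ⟨y', hy', y'', hy'', h⟩ := ihy
    obtain ⟨z', hz', z'', hz'', h'⟩ := hz
    refine ⟨_, mul_mem hy' hz', _, add_mem (mul_mem hy'' hz') (mul_mem hy hz''), ?_⟩
    rw [mul_assoc, h', mul_add, ← mul_assoc, h]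
    noncomm_ring

theorem isNoetherianRing [IsNoetherianRing R] : IsNoetherianRing (OqSL2 R sqq) := by
  have := isNoetherianRing_adjoinABC (R := R) (sqq := sqq)
  refine isNoetherianRing_of_ore
    (f := ((adjoinABC R sqq).val : adjoinABC R sqq →+* OqSL2 R sqq)) (x := d R sqq)
    (fun y => ?_) (fun y => ?_) fun V h1 hf hd => ?_
  · obtain ⟨y', hy', y'', hy'', h⟩ := d_mul_mem_adjoinABC y.2
    exact ⟨⟨y', hy'⟩, ⟨y'', hy''⟩, h⟩
  · obtain ⟨y', hy', y'', hy'', h⟩ := mul_d_mem_adjoinABC y.2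
    exact ⟨⟨y', hy'⟩, ⟨y'', hy''⟩, h⟩
  · exact eq_top_of_mul_mem V h1 (fun r => hf (algebraMap R _ r)) (hf ⟨_, a_mem_adjoinABC⟩)
      (hf ⟨_, b_mem_adjoinABC⟩) (hf ⟨_, c_mem_adjoinABC⟩) hd

end Noetherian

section Domain

variable (R sqq) in
/-- The monomial of degree `n` in `a` and `d = a⁻¹`: `a ^ n` for `n ≥ 0` and `d ^ (-n)`
for `n < 0`. -/
noncomputable def adPow : ℤ → OqSL2 R sqq
  | Int.ofNat n => a R sqq ^ n
  | Int.negSucc n => d R sqq ^ (n + 1)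

theorem adPow_natCast (n : ℕ) : adPow R sqq n = a R sqq ^ n := rfl

theorem adPow_neg_natCast (n : ℕ) : adPow R sqq (-n) = d R sqq ^ n := by
  cases n with
  | zero => exact (pow_zero _).trans (pow_zero _).symm
  | succ n => rfl

variable {ι : MvPolynomial (Fin 2) R →ₐ[R] OqSL2 R sqq}

theorem a_mul_adPow (hb : ι (X 0) = b R sqq) (hc : ι (X 1) = c R sqq) (n : ℤ) :
    ∃ p, a R sqq * adPow R sqq n = ι p * adPow R sqq (n + 1) := by
  obtain ⟨n, rfl | rfl⟩ := n.eq_nat_or_neg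
  · refine ⟨1, ?_⟩
    rw [map_one, one_mul, ← Nat.cast_succ, adPow_natCast, adPow_natCast, pow_succ']
  · cases n with
    | zero =>
      refine ⟨1, ?_⟩
      rw [adPow_neg_natCast, map_one, one_mul]
      simpa using (adPow_natCast 1).symm
    | succ n =>
      refine ⟨1 + ((qSq sqq)⁻¹ : Rˣ).1 • (X 0 * X 1), ?_⟩
      rw [adPow_neg_natCast, show -((n + 1 : ℕ) : ℤ) + 1 = -(n : ℤ) by push_cast; ring,
        adPow_neg_natCast, pow_succ', ← mul_assoc, a_mul_d]
      simp [hb, hc]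

theorem d_mul_adPow (hb : ι (X 0) = b R sqq) (hc : ι (X 1) = c R sqq) (n : ℤ) :
    ∃ p, d R sqq * adPow R sqq n = ι p * adPow R sqq (n - 1) := by
  obtain ⟨n, rfl | rfl⟩ := n.eq_nat_or_neg
  · cases n with
    | zero =>
      refine ⟨1, ?_⟩
      rw [adPow_natCast, map_one, one_mul]
      simpa using (adPow_neg_natCast 1).symm
    | succ n =>
      refine ⟨1 + (qSq sqq).1 • (X 0 * X 1), ?_⟩
      rw [adPow_natCast, show ((n + 1 : ℕ) : ℤ) - 1 = (n : ℤ) by push_cast; ring,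
        adPow_natCast, pow_succ', ← mul_assoc, d_mul_a]
      simp [hb, hc]
  · refine ⟨1, ?_⟩
    rw [map_one, one_mul, show -(n : ℤ) - 1 = -((n + 1 : ℕ) : ℤ) by push_cast; ring,
      adPow_neg_natCast, adPow_neg_natCast, pow_succ']

/-- The normal form map `∑ pₙ tⁿ ↦ ∑ ι pₙ * adPow n`. -/
noncomputable def normalForm (ι : MvPolynomial (Fin 2) R →ₐ[R] OqSL2 R sqq) :
    (ℤ →₀ MvPolynomial (Fin 2) R) →+ OqSL2 R sqq :=
  Finsupp.liftAddHom fun n => (AddMonoidHom.mulRight (adPow R sqq n)).comp ι.toRingHom.toAddMonoidHom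

theorem normalForm_single (n : ℤ) (p : MvPolynomial (Fin 2) R) :
    normalForm ι (Finsupp.single n p) = ι p * adPow R sqq n := by
  simp [normalForm]

theorem normalForm_surjective (hb : ι (X 0) = b R sqq) (hc : ι (X 1) = c R sqq) :
    Function.Surjective (normalForm ι) := by
  have hstab : ∀ y, (∀ p n, y * (ι p * adPow R sqq n) ∈ (normalForm ι).range) →
      ∀ v ∈ (normalForm ι).range, y * v ∈ (normalForm ι).range := by
    rintro y hy _ ⟨g, rfl⟩
    induction g using Finsupp.induction_linear with
    | zero => simp
    | add g h hg hh => rw [map_add, mul_add]; exact add_mem hg hh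
    | single n p => rw [normalForm_single]; exact hy p n
  have hι : ∀ r, ∀ v ∈ (normalForm ι).range, ι r * v ∈ (normalForm ι).range := fun r =>
    hstab _ fun p n => ⟨Finsupp.single n (r * p), by rw [normalForm_single, map_mul, mul_assoc]⟩
  rw [← AddMonoidHom.range_eq_top]
  refine eq_top_of_mul_mem _ ⟨Finsupp.single 0 1, ?_⟩ (fun r => ?_) (hstab _ fun p n => ?_)
    (hb ▸ hι _) (hc ▸ hι _) (hstab _ fun p n => ?_)
  · rw [normalForm_single, map_one, one_mul]
    exact pow_zero _
  · rw [← ι.commutes]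
    exact hι _
  · obtain ⟨r, hr⟩ := a_mul_adPow hb hc n
    refine ⟨Finsupp.single (n + 1) (scaleVars (qSq sqq)⁻¹ p * r), ?_⟩
    rw [normalForm_single, ← mul_assoc, a_mul_eq hb hc, mul_assoc, hr, map_mul, mul_assoc]
  · obtain ⟨r, hr⟩ := d_mul_adPow hb hc n
    refine ⟨Finsupp.single (n - 1) (scaleVars (qSq sqq) p * r), ?_⟩
    rw [normalForm_single, ← mul_assoc, d_mul_eq hb hc, mul_assoc, hr, map_mul, mul_assoc]

open SkewMonoidAlgebra in
/-- The realization of `O_{q²}(sl₂)` in a skew Laurent polynomial ring over `R[b, c]`. -/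
theorem exists_algHom_skewLaurent [MulSemiringAction (Multiplicative ℤ) (MvPolynomial (Fin 2) R)]
    [SMulCommClass (Multiplicative ℤ) R (MvPolynomial (Fin 2) R)]
    (h : ∀ i, Multiplicative.ofAdd (1 : ℤ) • (X i : MvPolynomial (Fin 2) R) =
      ((qSq sqq)⁻¹ : Rˣ).1 • X i) :
    ∃ φ : OqSL2 R sqq →ₐ[R] SkewMonoidAlgebra (MvPolynomial (Fin 2) R) (Multiplicative ℤ),
      φ (a R sqq) = single (Multiplicative.ofAdd 1) 1 ∧ φ (b R sqq) = single 1 (X 0) ∧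
      φ (c R sqq) = single 1 (X 1) ∧
      φ (d R sqq) = single (Multiplicative.ofAdd (-1)) (1 + (qSq sqq).1 • (X 0 * X 1)) := by
  have h' : ∀ i, Multiplicative.ofAdd (-1 : ℤ) • (X i : MvPolynomial (Fin 2) R) =
      (qSq sqq).1 • X i := fun i => by
    rw [ofAdd_neg, inv_smul_eq_iff, smul_comm, h, smul_smul, Units.mul_inv, one_smul]
  let ψ : FreeAlgebra R (Fin 4) →ₐ[R]
      SkewMonoidAlgebra (MvPolynomial (Fin 2) R) (Multiplicative ℤ) :=
    FreeAlgebra.lift R ![single (Multiplicative.ofAdd 1) 1, single 1 (X 0), single 1 (X 1),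
      single (Multiplicative.ofAdd (-1)) (1 + (qSq sqq).1 • (X 0 * X 1))]
  have hψ0 : ψ (FreeAlgebra.ι R 0) = single (Multiplicative.ofAdd 1) 1 := by simp [ψ]
  have hψ1 : ψ (FreeAlgebra.ι R 1) = single 1 (X 0) := by simp [ψ]
  have hψ2 : ψ (FreeAlgebra.ι R 2) = single 1 (X 1) := by simp [ψ]
  have hψ3 : ψ (FreeAlgebra.ι R 3) =
      single (Multiplicative.ofAdd (-1)) (1 + (qSq sqq).1 • (X 0 * X 1)) := by simp [ψ]
  have hψ : ∀ ⦃y z⦄, OSL2Rel R sqq y z → ψ y = ψ z := by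
    intro y z hyz
    induction hyz with
    | ca | ba =>
      simp only [map_mul, map_smul, hψ0, hψ1, hψ2, single_mul_single, smul_single, one_smul,
        smul_one, mul_one, one_mul, h, smul_smul, Units.mul_inv]
    | db | dc =>
      simp only [map_mul, map_smul, hψ1, hψ2, hψ3, single_mul_single, smul_single, one_smul,
        mul_one, one_mul, h', mul_smul_comm]
      rw [mul_comm]
    | bc =>
      simp only [map_mul, hψ1, hψ2, single_mul_single, one_smul, mul_one]
      rw [mul_comm]
    | ad =>
      rw [zpow_neg, map_sub, map_one, sub_eq_iff_eq_add, SkewMonoidAlgebra.one_def]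
      simp only [map_mul, map_smul, hψ0, hψ1, hψ2, hψ3, single_mul_single, smul_single, one_smul,
        mul_one, one_mul, ← ofAdd_add, ← single_add, smul_add, smul_one]
      simp only [smul_comm (Multiplicative.ofAdd (1 : ℤ)), smul_mul', h, smul_mul_smul_comm,
        smul_smul, Units.mul_inv_cancel_left]
      rfl
    | da =>
      rw [map_sub, map_one, sub_eq_iff_eq_add, SkewMonoidAlgebra.one_def]
      simp only [map_mul, map_smul, hψ0, hψ1, hψ2, hψ3, single_mul_single, smul_single, one_smul,
        mul_one, smul_one, ← ofAdd_add, ← single_add]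
      rfl
  have hπ (i : Fin 4) : RingQuot.liftAlgHom R ⟨ψ, hψ⟩
      (RingQuot.mkAlgHom R (OSL2Rel R sqq) (FreeAlgebra.ι R i)) = ψ (FreeAlgebra.ι R i) :=
    RingQuot.liftAlgHom_mkAlgHom_apply ..
  refine ⟨RingQuot.liftAlgHom R ⟨ψ, hψ⟩, (hπ 0).trans ?_, (hπ 1).trans ?_, (hπ 2).trans ?_,
    (hπ 3).trans ?_⟩ <;> simp [ψ]

theorem noZeroDivisors_of_action [IsDomain R]
    [MulSemiringAction (Multiplicative ℤ) (MvPolynomial (Fin 2) R)]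
    [SMulCommClass (Multiplicative ℤ) R (MvPolynomial (Fin 2) R)]
    (h : ∀ i, Multiplicative.ofAdd (1 : ℤ) • (X i : MvPolynomial (Fin 2) R) =
      ((qSq sqq)⁻¹ : Rˣ).1 • X i) : NoZeroDivisors (OqSL2 R sqq) := by
  obtain ⟨φ, φa, φb, φc, φd⟩ := exists_algHom_skewLaurent h
  obtain ⟨ι, hb, hc⟩ := MvPolynomial.exists_algHom_of_commute (R := R) (commute_b_c (sqq := sqq))
  have hι (p) : φ (ι p) = SkewMonoidAlgebra.single 1 p := by
    suffices (φ.comp ι).toRingHom = SkewMonoidAlgebra.singleOneRingHom from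
      DFunLike.congr_fun this p
    refine MvPolynomial.ringHom_ext (fun r => ?_) fun i => ?_
    · exact (φ.comp ι).commutes r
    · fin_cases i
      · exact (congrArg φ hb).trans φb
      · exact (congrArg φ hc).trans φc
  have hv : (1 + (qSq sqq).1 • (X 0 * X 1) : MvPolynomial (Fin 2) R) ≠ 0 := fun h0 => by
    simpa using congrArg (MvPolynomial.eval 0) h0
  have hw : ∀ n : ℤ, ∃ u : MvPolynomial (Fin 2) R, u ≠ 0 ∧
      φ (adPow R sqq n) = SkewMonoidAlgebra.single (Multiplicative.ofAdd n) u := by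
    intro n
    obtain ⟨n, rfl | rfl⟩ := n.eq_nat_or_neg
    · rw [adPow_natCast, map_pow, φa]
      simpa [← ofAdd_nsmul] using SkewMonoidAlgebra.exists_single_pow
        (Multiplicative.ofAdd (1 : ℤ)) (one_ne_zero (α := MvPolynomial (Fin 2) R)) n
    · rw [adPow_neg_natCast, map_pow, φd]
      simpa [← ofAdd_nsmul] using SkewMonoidAlgebra.exists_single_pow
        (Multiplicative.ofAdd (-1 : ℤ)) hv n
  choose u hu hφu using hw
  have hcoeff (g : ℤ →₀ MvPolynomial (Fin 2) R) (n : ℤ) :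
      (φ (normalForm ι g)).coeff (Multiplicative.ofAdd n) = g n * u n := by
    induction g using Finsupp.induction_linear with
    | zero => simp
    | add g g' hg hg' =>
      rw [map_add, map_add, SkewMonoidAlgebra.coeff_add, Finsupp.add_apply, hg, hg',
        Finsupp.add_apply, add_mul]
    | single m p =>
      rw [normalForm_single, map_mul, hι, hφu, SkewMonoidAlgebra.single_mul_single, one_mul,
        one_smul, SkewMonoidAlgebra.coeff_single, Finsupp.single_apply, Finsupp.single_apply]
      by_cases hmn : m = n
      · subst hmn; simp
      · simp [hmn]
  have hφ : Function.Injective φ := by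
    refine (injective_iff_map_eq_zero φ).2 fun z hz => ?_
    obtain ⟨g, rfl⟩ := normalForm_surjective hb hc z
    suffices g = 0 by rw [this, map_zero]
    ext1 n
    have := hcoeff g n
    rw [hz, SkewMonoidAlgebra.coeff_zero, Finsupp.zero_apply, eq_comm] at this
    exact (mul_eq_zero.1 this).resolve_right (hu n)
  have := SkewMonoidAlgebra.noZeroDivisors (k := MvPolynomial (Fin 2) R) (G := Multiplicative ℤ)
  exact hφ.noZeroDivisors φ (map_zero φ) (map_mul φ)

theorem noZeroDivisors [IsDomain R] : NoZeroDivisors (OqSL2 R sqq) := by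
  let := scaleAction (σ := Fin 2) (qSq sqq)⁻¹
  have hact : ∀ n : Multiplicative ℤ, ∀ p : MvPolynomial (Fin 2) R,
      n • p = (scaleVars (qSq sqq)⁻¹ ^ n.toAdd) p := fun _ _ => rfl
  have : SMulCommClass (Multiplicative ℤ) R (MvPolynomial (Fin 2) R) :=
    ⟨fun n r p => by rw [hact, hact, map_smul]⟩
  refine noZeroDivisors_of_action fun i => ?_
  rw [hact, toAdd_ofAdd, zpow_one, scaleVars_X]

end Domain

end OqSL2

/-- If `R` is a commutative Noetherian integral domain, then
`O_{q²}(sl₂)` is a Noetherian ring with no zero divisors (a Noetherian domain). -/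
theorem OqSL2_noetherian_domain (R : Type) [CommRing R] [IsDomain R]
    [IsNoetherianRing R] (sqq : Rˣ) :
    IsNoetherianRing (OqSL2 R sqq) ∧ NoZeroDivisors (OqSL2 R sqq) :=
  ⟨OqSL2.isNoetherianRing, OqSL2.noZeroDivisors⟩
end
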